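/- Let a : ℕ × ℕ → ℤ be the double sequence determined by the recurrence a_{l+1,m+1} = a_{l,m} + a_{l+1,m} + a_{l,m+1} for all l,m ≥ 0, with boundary values a_{0,0} = 1 and a_{l,0} = a_{0,m} = 0 for all l,m ≥ 1. Then for all l,m ≥ 1, a_{l,m} = Σ_{i+j = m-1} C(l-1, i) · C(j+l-1, j), where C denotes the binomial coefficient and the sum runs over all pairs of nonnegative integers i, j with i + j = m - 1. -/

import Mathlib

open PowerSeries in
/-- The generating function `(1 + X) ^ n / (1 - X) ^ (n + 1)` of the `n`-th row of
Delannoy numbers. -/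
noncomputable def delannoySeries (n : ℕ) : PowerSeries ℤ :=
  (1 + X) ^ n * mk fun j => ((j + n).choose j : ℤ)

open PowerSeries in
theorem mk_choose_succ_mul_one_sub_X (n : ℕ) :
    (mk fun j => ((j + (n + 1)).choose j : ℤ)) * (1 - X) =
      mk fun j => ((j + n).choose j : ℤ) := by
  ext j
  cases j with
  | zero => simp [mul_sub]
  | succ j =>
    rw [mul_sub, mul_one, map_sub, coeff_succ_mul_X, coeff_mk, coeff_mk, coeff_mk,
      show j + 1 + (n + 1) = (j + (n + 1)) + 1 by ring, Nat.choose_succ_succ,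
      show j + 1 + n = j + (n + 1) by ring]
    push_cast
    ring

open PowerSeries in
theorem delannoySeries_succ_mul_one_sub_X (n : ℕ) :
    delannoySeries (n + 1) * (1 - X) = delannoySeries n * (1 + X) := by
  rw [delannoySeries, mul_assoc, mk_choose_succ_mul_one_sub_X, delannoySeries]
  ring

open PowerSeries in
theorem coeff_succ_delannoySeries_succ (n m : ℕ) :
    coeff (m + 1) (delannoySeries (n + 1)) =
      coeff m (delannoySeries n) + coeff m (delannoySeries (n + 1)) +
        coeff (m + 1) (delannoySeries n) := by
  have h := congrArg (coeff (m + 1)) (delannoySeries_succ_mul_one_sub_X n)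
  simp only [mul_sub, mul_add, mul_one, map_sub, map_add, coeff_succ_mul_X] at h
  linarith

open PowerSeries in
theorem coeff_zero_delannoySeries (n : ℕ) : coeff 0 (delannoySeries n) = 1 := by
  simp [delannoySeries]

open PowerSeries in
theorem coeff_delannoySeries_zero (m : ℕ) : coeff m (delannoySeries 0) = 1 := by
  simp [delannoySeries]

open PowerSeries in
theorem coeff_delannoySeries (n m : ℕ) :
    coeff m (delannoySeries n) =
      ∑ p ∈ Finset.HasAntidiagonal.antidiagonal m,
        (n.choose p.1 * (p.2 + n).choose p.2 : ℤ) := by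
  have h (i : ℕ) : coeff i ((1 + X : PowerSeries ℤ) ^ n) = n.choose i := by
    have := Polynomial.coeff_one_add_X_pow ℤ n i
    rw [← this, ← Polynomial.coeff_coe]
    simp
  simp [delannoySeries, coeff_mul, h]

open PowerSeries in
theorem eq_coeff_delannoySeries (a : ℕ × ℕ → ℤ)
    (hrec : ∀ l m : ℕ, a (l + 1, m + 1) = a (l, m) + a (l + 1, m) + a (l, m + 1))
    (h00 : a (0, 0) = 1)
    (hl0 : ∀ l : ℕ, 1 ≤ l → a (l, 0) = 0)
    (h0m : ∀ m : ℕ, 1 ≤ m → a (0, m) = 0) (n m : ℕ) :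
    a (n + 1, m + 1) = coeff m (delannoySeries n) := by
  induction n generalizing m with
  | zero =>
    rw [coeff_delannoySeries_zero]
    induction m with
    | zero => rw [hrec, h00, hl0 _ (by simp), h0m _ (by simp)]; rfl
    | succ m ih => rw [hrec, ih, h0m _ (by simp), h0m _ (by simp)]; rfl
  | succ n ihn =>
    induction m with
    | zero =>
      rw [hrec, ihn, hl0 _ (by simp), hl0 _ (by simp), coeff_zero_delannoySeries,
        coeff_zero_delannoySeries]
      rfl
    | succ m ihm => rw [hrec, ihn, ihn, ihm, coeff_succ_delannoySeries_succ]


/-- The double sequence determined by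
`a_{l+1,m+1} = a_{l,m} + a_{l+1,m} + a_{l,m+1}` with boundary values
`a_{0,0} = 1` and `a_{l,0} = a_{0,m} = 0` for `l,m ≥ 1` satisfies, for `l,m ≥ 1`,
`a_{l,m} = Σ_{i+j=m-1} C(l-1,i)·C(j+l-1,j)`. -/
theorem stmt2 (a : ℕ × ℕ → ℤ)
    (hrec : ∀ l m : ℕ, a (l + 1, m + 1) = a (l, m) + a (l + 1, m) + a (l, m + 1))
    (h00 : a (0, 0) = 1)
    (hl0 : ∀ l : ℕ, 1 ≤ l → a (l, 0) = 0)
    (h0m : ∀ m : ℕ, 1 ≤ m → a (0, m) = 0) :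
    ∀ l m : ℕ, 1 ≤ l → 1 ≤ m →
      a (l, m) = ∑ p ∈ Finset.HasAntidiagonal.antidiagonal (m - 1),
        ((l - 1).choose p.1 * (p.2 + l - 1).choose p.2 : ℤ) := by
  intro l m hl hm
  obtain ⟨n, rfl⟩ := Nat.exists_eq_add_of_le' hl
  obtain ⟨k, rfl⟩ := Nat.exists_eq_add_of_le' hm
  rw [eq_coeff_delannoySeries a hrec h00 hl0 h0m, coeff_delannoySeries]
  rfl
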